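/- arXiv:2203.07174 — 2 statements merged into one kernel-verified Lean document; each statement's English description precedes it below -/
import Mathlib

section
/- Let S be a commutative noetherian ring, S^e = S ⊗_k S for S an algebra over a field k, and let N be an (S^e)-module, regarded as an S-module via a k-algebra map Δ : S → S^e. For a prime p of S with N finitely generated over S^e: p lies in the small support supp_S N if and only if supp_{S^e}(N) ∩ supp_{S^e}(S^e ⊗_S^L κ(p)) ≠ ∅. (Here the S-module structure on S^e used to form S^e ⊗_S^L κ(p) is via Δ.) -/
open CategoryTheory TensorProduct

/-- The residue field `κ(p) = S_p / p S_p` at a prime `p`. -/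
abbrev resField {S : Type} [CommRing S] (p : PrimeSpectrum S) : Type :=
  IsLocalRing.ResidueField (Localization.AtPrime p.asIdeal)

/-- An `(S ⊗ₖ S)`-module viewed as an `S`-module by restriction of scalars along a
`k`-algebra map `Δ : S → S ⊗ₖ S`. -/
noncomputable def restrictDelta {k S : Type} [Field k] [CommRing S] [Algebra k S]
    (Δ : S →ₐ[k] (S ⊗[k] S)) (M : Type) [AddCommGroup M] [Module (S ⊗[k] S) M] :
    ModuleCat S :=
  @ModuleCat.of S _ M _ (Module.compHom M Δ.toRingHom)

namespace Core

def VV {A : Type} [CommRing A] {K : ℕ → Type} [∀ i, AddCommGroup (K i)] [∀ i, Module A (K i)]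
    (d : ∀ i j, K i →ₗ[A] K j) (M : Type) [AddCommGroup M] [Module A M] (i : ℕ) : Prop :=
  ∀ z : M ⊗[A] K i, (d i (i-1)).lTensor M z = 0 →
    ∃ w : M ⊗[A] K (i+1), (d (i+1) i).lTensor M w = z

section
variable {A : Type} [CommRing A] {K : ℕ → Type} [∀ i, AddCommGroup (K i)] [∀ i, Module A (K i)]
  {d : ∀ i j, K i →ₗ[A] K j}
  {M M' M'' : Type} [AddCommGroup M] [Module A M] [AddCommGroup M'] [Module A M']
  [AddCommGroup M''] [Module A M'']

lemma comm {P Q : Type} [AddCommGroup P] [Module A P] [AddCommGroup Q] [Module A Q]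
    (f : M →ₗ[A] M') (e : P →ₗ[A] Q) (z : M ⊗[A] P) :
    f.rTensor Q (e.lTensor M z) = e.lTensor M' (f.rTensor P z) := by
  induction z with
  | zero => simp
  | add x y hx hy => simp only [map_add, hx, hy]
  | tmul x y => simp

lemma dd (hd : ∀ i, d i (i-1) ∘ₗ d (i+1) i = 0) (i : ℕ) (w : M ⊗[A] K (i+1)) :
    (d i (i-1)).lTensor M ((d (i+1) i).lTensor M w) = 0 := by
  rw [← LinearMap.lTensor_comp_apply, hd]; simp

variable {f : M' →ₗ[A] M} {g : M →ₗ[A] M''}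

lemma L1 [∀ i, Module.Flat A (K i)] (hd : ∀ i, d i (i-1) ∘ₗ d (i+1) i = 0)
    (hf : Function.Injective f) (hg : Function.Surjective g)
    (h : Function.Exact f g) (i : ℕ) (h1 : VV d M' i) (h2 : VV d M'' i) : VV d M i := by
  intro z hz
  obtain ⟨w'', hw''⟩ := h2 (g.rTensor _ z) (by rw [← comm, hz, map_zero])
  obtain ⟨w, rfl⟩ := LinearMap.rTensor_surjective (K (i+1)) hg w''
  obtain ⟨z', hz'⟩ := (rTensor_exact (K i) h hg (z - (d (i+1) i).lTensor M w)).1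
    (by rw [map_sub, comm, hw'', sub_self])
  obtain ⟨w', hw'⟩ := h1 z' (by
    apply Module.Flat.rTensor_preserves_injective_linearMap (M := K (i-1)) f hf
    rw [comm, hz', map_sub, hz, dd hd]; simp)
  refine ⟨w + f.rTensor _ w', ?_⟩
  rw [map_add, ← comm, hw', hz']; abel

lemma L2 [∀ i, Module.Flat A (K i)] (hd : ∀ i, d i (i-1) ∘ₗ d (i+1) i = 0) (hd0 : d 0 0 = 0)
    (hf : Function.Injective f) (hg : Function.Surjective g)
    (h : Function.Exact f g) (i : ℕ) (h1 : ∀ j, i = j + 1 → VV d M' j) (h2 : VV d M i) :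
    VV d M'' i := by
  intro z'' hz''
  obtain ⟨z, rfl⟩ := LinearMap.rTensor_surjective (K i) hg z''
  have key : ∃ u : M' ⊗[A] K i, (d i (i-1)).lTensor M (f.rTensor _ u) = (d i (i-1)).lTensor M z := by
    cases i with
    | zero => exact ⟨0, by simp [hd0]⟩
    | succ j =>
      obtain ⟨y, hy⟩ := (rTensor_exact (K j) h hg ((d (j+1) j).lTensor M z)).1
        (by rw [comm]; exact hz'')
      obtain ⟨u, hu⟩ := h1 j rfl y (by
        apply Module.Flat.rTensor_preserves_injective_linearMap (M := K (j-1)) f hf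
        rw [comm, hy, dd hd]; simp)
      exact ⟨u, by rw [← comm]; exact (congrArg _ hu).trans hy⟩
  obtain ⟨u, hu⟩ := key
  obtain ⟨w, hw⟩ := h2 (z - f.rTensor _ u) (by rw [map_sub, hu, sub_self])
  refine ⟨g.rTensor _ w, ?_⟩
  rw [← comm, hw, map_sub, sub_eq_self]
  exact (rTensor_exact (K i) h hg _).2 ⟨u, rfl⟩

lemma L3 [∀ i, Module.Flat A (K i)] (hd : ∀ i, d i (i-1) ∘ₗ d (i+1) i = 0)
    (hf : Function.Injective f) (hg : Function.Surjective g)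
    (h : Function.Exact f g) (i : ℕ) (h1 : VV d M'' (i+1)) (z : M' ⊗[A] K i)
    (w : M ⊗[A] K (i+1)) (hw : (d (i+1) i).lTensor M w = f.rTensor _ z) :
    ∃ w', (d (i+1) i).lTensor M' w' = z := by
  have hgf : ∀ j, ∀ y : M' ⊗[A] K j, g.rTensor _ (f.rTensor _ y) = 0 :=
    fun j y => (rTensor_exact (K j) h hg _).2 ⟨y, rfl⟩
  obtain ⟨u'', hu''⟩ := h1 (g.rTensor _ w) (by
    change (d (i+1) i).lTensor M'' _ = 0
    rw [← comm, hw, hgf])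
  obtain ⟨u, rfl⟩ := LinearMap.rTensor_surjective (K (i+1+1)) hg u''
  obtain ⟨w', hw'⟩ := (rTensor_exact (K (i+1)) h hg (w - (d (i+1+1) (i+1)).lTensor M u)).1
    (by rw [map_sub, comm, hu'', sub_self])
  refine ⟨w', ?_⟩
  apply Module.Flat.rTensor_preserves_injective_linearMap (M := K i) f hf
  have := dd (M := M) hd (i+1) u
  rw [comm, hw', map_sub, hw, sub_eq_self]
  exact this

lemma equiv (e : M ≃ₗ[A] M') (i : ℕ) (h : VV d M' i) : VV d M i := by
  intro z hz
  obtain ⟨w, hw⟩ := h (e.toLinearMap.rTensor _ z) (by rw [← comm, hz, map_zero])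
  refine ⟨e.symm.toLinearMap.rTensor _ w, ?_⟩
  rw [← comm, hw, ← LinearMap.rTensor_comp_apply]
  simp

lemma devissage [IsNoetherianRing A] [∀ i, Module.Flat A (K i)]
    (hd : ∀ i, d i (i-1) ∘ₗ d (i+1) i = 0) (i : ℕ) (M : Type) [AddCommGroup M] [Module A M]
    [hM : Module.Finite A M]
    (h : ∀ q ∈ Module.support A M, VV d (A ⧸ q.asIdeal) i) : VV d M i := by
  revert h
  induction hM using IsNoetherianRing.induction_on_isQuotientEquivQuotientPrime A with
  | subsingleton N =>
    intro _ z _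
    exact ⟨0, Subsingleton.elim _ _⟩
  | quotient N p f =>
    intro h
    refine equiv f i (h p ?_)
    rw [f.support_eq, Module.support_of_algebra]
    simp
  | exact N₁ N₂ N₃ f g hf hg hfg h₁ h₃ =>
    intro h
    rw [Module.support_of_exact hfg hf hg] at h
    exact L1 hd hf hg hfg i (h₁ fun q hq => h q (Or.inl hq)) (h₃ fun q hq => h q (Or.inr hq))

lemma strict (q q' : PrimeSpectrum A) (a : A) (ha : a ∉ q.asIdeal)
    (h1 : ∀ x ∈ q.asIdeal, ∀ m : M, x • m = 0) (h2 : ∀ m : M, a • m = 0)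
    (hq' : q' ∈ Module.support A M) : q < q' := by
  have h := Module.annihilator_le_of_mem_support hq'
  refine lt_of_le_of_ne (fun x hx => h (Module.mem_annihilator.2 (h1 x hx))) ?_
  rintro rfl
  exact ha (h (Module.mem_annihilator.2 h2))

/-- abstract residue field properties -/
structure RF (q : PrimeSpectrum A) (E : Type) [AddCommGroup E] [Module A E]
    (ι : (A ⧸ q.asIdeal) →ₗ[A] E) : Prop where
  inj : Function.Injective ι
  den : ∀ x : E, ∃ a ∉ q.asIdeal, ∃ y, a • x = ι y
  inv : ∀ a ∉ q.asIdeal, ∃ f : E →ₗ[A] E, ∀ x, f (a • x) = x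

lemma RF.den' {q : PrimeSpectrum A} {E : Type} [AddCommGroup E] [Module A E]
    {ι : (A ⧸ q.asIdeal) →ₗ[A] E} (h : RF q E ι) {P : Type} [AddCommGroup P] [Module A P]
    (w : E ⊗[A] P) : ∃ a ∉ q.asIdeal, ∃ y, a • w = ι.rTensor P y := by
  induction w with
  | zero => exact ⟨1, fun h => q.2.ne_top ((Ideal.eq_top_iff_one _).2 h), 0, by simp⟩
  | tmul x p =>
    obtain ⟨a, ha, y, hy⟩ := h.den x
    exact ⟨a, ha, y ⊗ₜ p, by simp [← hy, smul_tmul']⟩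
  | add u v hu hv =>
    obtain ⟨a, ha, y, hy⟩ := hu
    obtain ⟨b, hb, z, hz⟩ := hv
    refine ⟨a * b, fun h => (q.2.mem_or_mem h).elim ha hb, b • y + a • z, ?_⟩
    rw [map_add, map_smul, map_smul, ← hy, ← hz, smul_add, smul_smul, smul_smul, mul_comm]

lemma RF.exists_map {q : PrimeSpectrum A} {E : Type} [AddCommGroup E] [Module A E]
    {ι : (A ⧸ q.asIdeal) →ₗ[A] E} (h : RF q E ι) {N : Type} [AddCommGroup N] [Module A N]
    [Module.Finite A N] (φ : N →ₗ[A] E) (hφ : φ ≠ 0) :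
    ∃ ψ : N →ₗ[A] (A ⧸ q.asIdeal), ψ ≠ 0 := by
  obtain ⟨s, hs⟩ := Module.Finite.fg_top (R := A) (M := N)
  choose a ha y hy using h.den
  let b := ∏ n ∈ s, a (φ n)
  have hb : b ∉ q.asIdeal := fun hb => by
    obtain ⟨n, _, hn⟩ := (Ideal.IsPrime.prod_mem_iff (hp := q.2)).1 hb
    exact ha _ hn
  have hr : LinearMap.range (b • φ) ≤ LinearMap.range ι := by
    rw [LinearMap.range_eq_map, ← hs, Submodule.map_span_le]
    intro n hn
    classical
    refine ⟨(∏ n ∈ s.erase n, a (φ n)) • y (φ n), ?_⟩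
    rw [map_smul, ← hy, smul_smul, mul_comm, Finset.mul_prod_erase s (fun n => a (φ n)) hn]
    rfl
  let e := LinearEquiv.ofInjective ι h.inj
  let φ' := (b • φ).codRestrict (LinearMap.range ι) (fun n => hr ⟨n, rfl⟩)
  refine ⟨e.symm.toLinearMap ∘ₗ φ', fun h0 => hφ ?_⟩
  ext n
  have h1 : e.symm (φ' n) = 0 := LinearMap.congr_fun h0 n
  have h2 : φ' n = 0 := by simpa using h1
  have h3 : b • φ n = 0 := congrArg Subtype.val h2
  obtain ⟨f, hf⟩ := h.inv b hb
  rw [← hf (φ n), h3, map_zero]; rfl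

lemma kappa_of_quot [∀ i, Module.Flat A (K i)]
    {q : PrimeSpectrum A} {E : Type} [AddCommGroup E] [Module A E]
    {ι : (A ⧸ q.asIdeal) →ₗ[A] E} (h : RF q E ι) (i : ℕ) (hq : VV d (A ⧸ q.asIdeal) i) :
    VV d E i := by
  intro z hz
  obtain ⟨a, ha, y, hy⟩ := h.den' z
  obtain ⟨w, hw⟩ := hq y (by
    apply Module.Flat.rTensor_preserves_injective_linearMap (M := K (i-1)) ι h.inj
    rw [comm, ← hy, map_smul, hz]; simp)
  obtain ⟨f, hf⟩ := h.inv a ha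
  refine ⟨f.rTensor _ (ι.rTensor _ w), ?_⟩
  rw [← comm, ← comm, hw, ← hy]
  have : f ∘ₗ (a • LinearMap.id) = LinearMap.id := by ext x; simpa using hf x
  have h2 := LinearMap.congr_fun (congrArg (LinearMap.rTensor (K i)) this) z
  rw [LinearMap.rTensor_comp_apply, LinearMap.rTensor_smul] at h2
  simpa using h2

lemma quot_of_kappa [IsNoetherianRing A] [∀ i, Module.Flat A (K i)]
    (hd : ∀ i, d i (i-1) ∘ₗ d (i+1) i = 0)
    {q : PrimeSpectrum A} {E : Type} [AddCommGroup E] [Module A E]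
    {ι : (A ⧸ q.asIdeal) →ₗ[A] E} (h : RF q E ι) (i : ℕ) (hq : VV d E i)
    (hlt : ∀ q', q < q' → VV d (A ⧸ q'.asIdeal) (i+1)) :
    VV d (A ⧸ q.asIdeal) i := by
  intro z hz
  obtain ⟨w, hw⟩ := hq (ι.rTensor _ z) (by rw [← comm, hz, map_zero])
  obtain ⟨a, ha, y, hy⟩ := h.den' w
  let f : (A ⧸ q.asIdeal) →ₗ[A] (A ⧸ q.asIdeal) := a • LinearMap.id
  have hf : Function.Injective f := by
    rw [injective_iff_map_eq_zero]
    intro x hx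
    obtain ⟨x, rfl⟩ := Ideal.Quotient.mk_surjective x
    have h1 : Ideal.Quotient.mk q.asIdeal (a * x) = 0 := hx
    rw [Ideal.Quotient.eq_zero_iff_mem] at h1 ⊢
    exact (q.2.mem_or_mem h1).resolve_left ha
  refine L3 hd hf (Submodule.mkQ_surjective (LinearMap.range f))
    (LinearMap.exact_map_mkQ_range f) i ?_ z y ?_
  · refine devissage hd _ _ fun q' hq' => hlt q' (strict q q' a ha ?_ ?_ hq')
    · intro x hx m
      obtain ⟨m, rfl⟩ := Submodule.mkQ_surjective _ m
      obtain ⟨m, rfl⟩ := Ideal.Quotient.mk_surjective m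
      rw [← map_smul]
      have : x • (Ideal.Quotient.mk q.asIdeal m) = 0 :=
        Ideal.Quotient.eq_zero_iff_mem.2 (Ideal.mul_mem_right _ _ hx)
      rw [this, map_zero]
    · intro m
      obtain ⟨m, rfl⟩ := Submodule.mkQ_surjective _ m
      rw [← map_smul]
      exact (Submodule.Quotient.mk_eq_zero _).2 ⟨m, rfl⟩
  · apply Module.Flat.rTensor_preserves_injective_linearMap (M := K i) ι h.inj
    rw [comm, ← hy, map_smul, hw]
    simp [f, LinearMap.rTensor_smul]

lemma wf (A : Type) [CommRing A] [IsNoetherianRing A] : WellFoundedGT (PrimeSpectrum A) :=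
  StrictMono.wellFoundedGT (f := PrimeSpectrum.asIdeal) (fun _ _ h => h)

theorem core [IsNoetherianRing A] [∀ i, Module.Flat A (K i)]
    (hd : ∀ i, d i (i-1) ∘ₗ d (i+1) i = 0) (hd0 : d 0 0 = 0)
    (E : PrimeSpectrum A → Type) [∀ q, AddCommGroup (E q)] [∀ q, Module A (E q)]
    (ι : ∀ q : PrimeSpectrum A, (A ⧸ q.asIdeal) →ₗ[A] E q) (hE : ∀ q, RF q (E q) (ι q))
    (N : Type) [AddCommGroup N] [Module A N] [Module.Finite A N]
    (hN : ∀ q ∈ Module.support A N, ∃ φ : N →ₗ[A] E q, φ ≠ 0) :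
    (∀ i, VV d N i) ↔ ∀ q ∈ Module.support A N, ∀ i, VV d (E q) i := by
  have := wf A
  constructor
  · intro h
    suffices H : ∀ i, ∀ q ∈ Module.support A N, VV d (A ⧸ q.asIdeal) i from
      fun q hq i => kappa_of_quot (hE q) i (H i q hq)
    intro i
    induction i using Nat.strong_induction_on with
    | h i ih =>
    intro q hq
    induction q using WellFoundedGT.induction with
    | ind q ihq =>
    obtain ⟨φ, hφ⟩ := hN q hq
    obtain ⟨ψ, hψ⟩ := (hE q).exists_map φ hφ
    obtain ⟨n, hn⟩ := DFunLike.ne_iff.1 hψ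
    obtain ⟨a, ha⟩ := Ideal.Quotient.mk_surjective (ψ n)
    have ha' : a ∉ q.asIdeal := fun h => hn (by
      rw [← ha, Ideal.Quotient.eq_zero_iff_mem.2 h]; rfl)
    have hJ : VV d (LinearMap.range ψ) i := by
      refine L2 hd hd0 (f := (LinearMap.ker ψ).subtype) (g := ψ.rangeRestrict)
        (Submodule.subtype_injective _) ψ.surjective_rangeRestrict ?_ i ?_ (h i)
      · rw [LinearMap.exact_iff, LinearMap.ker_rangeRestrict, Submodule.range_subtype]
      · rintro j rfl
        exact devissage hd j _ fun q' hq' => ih j (Nat.lt_succ_self j) q'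
          (Module.support_subset_of_injective _ (Submodule.subtype_injective _) hq')
    refine L1 hd (Submodule.subtype_injective _) (Submodule.mkQ_surjective (LinearMap.range ψ))
      (LinearMap.exact_subtype_mkQ _) i hJ ?_
    refine devissage hd i _ fun q' hq' => ?_
    have hlt : q < q' := by
      refine strict q q' a ha' ?_ ?_ hq'
      · intro x hx m
        obtain ⟨m, rfl⟩ := Submodule.mkQ_surjective _ m
        obtain ⟨m, rfl⟩ := Ideal.Quotient.mk_surjective m
        rw [← map_smul]
        have : x • (Ideal.Quotient.mk q.asIdeal m) = 0 :=
          Ideal.Quotient.eq_zero_iff_mem.2 (Ideal.mul_mem_right _ _ hx)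
        rw [this, map_zero]
      · intro m
        obtain ⟨m, rfl⟩ := Submodule.mkQ_surjective _ m
        obtain ⟨m, rfl⟩ := Ideal.Quotient.mk_surjective m
        rw [← map_smul]
        refine (Submodule.Quotient.mk_eq_zero _).2 ⟨m • n, ?_⟩
        rw [map_smul, ← ha]
        change Ideal.Quotient.mk q.asIdeal (m * a) = Ideal.Quotient.mk q.asIdeal (a * m)
        rw [mul_comm]
    exact ihq q' hlt (Module.mem_support_mono hlt.le hq)
  · intro h i
    refine devissage hd i N ?_
    intro q hq
    induction q using WellFoundedGT.induction generalizing i with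
    | ind q ihq =>
      exact quot_of_kappa hd (hE q) i (h q hq i) fun q' hlt =>
        ihq q' hlt (i+1) (Module.mem_support_mono hlt.le hq)
end
end Core

namespace Core
section
variable {A : Type} [CommRing A]

lemma rf (q : PrimeSpectrum A) :
    ∃ ι : (A ⧸ q.asIdeal) →ₗ[A] resField q, RF q (resField q) ι := by
  have hk : ∀ x : A, algebraMap A (resField q) x = 0 ↔ x ∈ q.asIdeal := fun x =>
    Ideal.algebraMap_residueField_eq_zero (I := q.asIdeal)
  refine ⟨Submodule.liftQ q.asIdeal (Algebra.linearMap A (resField q))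
    (fun x hx => (hk x).2 hx), ?_, ?_, ?_⟩
  · rw [injective_iff_map_eq_zero]
    intro x hx
    obtain ⟨x, rfl⟩ := Ideal.Quotient.mk_surjective x
    rw [Ideal.Quotient.eq_zero_iff_mem]
    exact (hk x).1 hx
  · intro x
    obtain ⟨x, rfl⟩ := IsLocalRing.residue_surjective x
    obtain ⟨y, ⟨s, hs⟩, rfl⟩ := IsLocalization.exists_mk'_eq q.asIdeal.primeCompl x
    refine ⟨s, hs, Ideal.Quotient.mk _ y, ?_⟩
    have h : s • IsLocalization.mk' (Localization.AtPrime q.asIdeal) y ⟨s, hs⟩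
      = algebraMap A _ y := by
      rw [Algebra.smul_def]; exact IsLocalization.mk'_spec' _ y ⟨s, hs⟩
    have h2 := congrArg (IsLocalRing.residue (Localization.AtPrime q.asIdeal)) h
    rw [Algebra.smul_def, map_mul] at h2
    rw [Algebra.smul_def]
    exact h2
  · intro a ha
    refine ⟨LinearMap.mulLeft A (algebraMap A (resField q) a)⁻¹, fun x => ?_⟩
    rw [LinearMap.mulLeft_apply, Algebra.smul_def, inv_mul_cancel_left₀]
    exact fun h => ha ((hk a).1 h)

lemma exists_functional (N : Type) [AddCommGroup N] [Module A N] [Module.Finite A N]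
    (q : PrimeSpectrum A) (hq : q ∈ Module.support A N) :
    ∃ φ : N →ₗ[A] resField q, φ ≠ 0 := by
  have h := (Module.mem_support_iff_nontrivial_residueField_tensorProduct (R := A) (M := N) q).1 hq
  change Nontrivial (resField q ⊗[A] N) at h
  obtain ⟨v, hv⟩ := exists_ne (0 : resField q ⊗[A] N)
  have hf : ∃ f : Module.Dual (resField q) (resField q ⊗[A] N), f v ≠ 0 := by
    by_contra! h0
    exact hv ((Module.forall_dual_apply_eq_zero_iff (resField q) v).1 h0)
  obtain ⟨f, hf⟩ := hf
  refine ⟨f.restrictScalars A ∘ₗ TensorProduct.mk A (resField q) N 1, fun h0 => hf ?_⟩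
  have : f = 0 := by
    apply TensorProduct.AlgebraTensorModule.curry_injective
    ext n
    exact LinearMap.congr_fun h0 n
  rw [this]; rfl

lemma vv_baseChange {S : Type} [CommRing S] [Algebra S A] {K : ℕ → Type}
    [∀ i, AddCommGroup (K i)] [∀ i, Module S (K i)]
    (d : ∀ i j, K i →ₗ[S] K j) (M : Type) [AddCommGroup M] [Module A M] [Module S M]
    [IsScalarTower S A M] (i : ℕ) :
    VV (A := S) d M i ↔ VV (A := A) (fun i j => (d i j).baseChange A) M i := by
  let e := fun i => TensorProduct.AlgebraTensorModule.cancelBaseChange S A A M (K i)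
  have he : ∀ i j z, e j (((d i j).baseChange A).lTensor M z) = (d i j).lTensor M (e i z) := by
    intro i j z
    induction z with
    | zero => simp
    | add x y hx hy => simp only [map_add, hx, hy]
    | tmul m z =>
    induction z with
    | zero => simp
    | add x y hx hy => simp only [map_add, tmul_add, hx, hy]
    | tmul a z => simp [e]
  constructor
  · intro h z hz
    obtain ⟨w, hw⟩ := h (e i z) (by rw [← he, hz, map_zero])
    refine ⟨(e _).symm w, (e _).injective ?_⟩
    rw [he, LinearEquiv.apply_symm_apply, hw]
  · intro h z hz
    obtain ⟨w, hw⟩ := h ((e i).symm z) ((e _).injective (by rw [he]; simpa using hz))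
    refine ⟨e _ w, ?_⟩
    rw [← he, hw, LinearEquiv.apply_symm_apply]

abbrev dd' {Y : ModuleCat A} (P : ProjectiveResolution Y) (i j : ℕ) :
    P.complex.X i →ₗ[A] P.complex.X j := (P.complex.d i j).hom

lemma tor_iff (M Y : ModuleCat A) (P : ProjectiveResolution Y) (i : ℕ) :
    Nontrivial (((Tor (ModuleCat A) i).obj M).obj Y) ↔ ¬ VV (dd' P) M i := by
  rw [← not_subsingleton_iff_nontrivial, not_iff_not, ← ModuleCat.isZero_iff_subsingleton]
  rw [Tor_obj, (P.isoLeftDerivedObj _ i).isZero_iff]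
  change Limits.IsZero (HomologicalComplex.homology _ i) ↔ _
  rw [← HomologicalComplex.exactAt_iff_isZero_homology,
    HomologicalComplex.exactAt_iff' _ (i+1) i (i-1) (by simp)
      (by cases i <;> simp), ShortComplex.moduleCat_exact_iff]
  rfl

lemma tor_zero_of (N : Type) [AddCommGroup N] [Module A N] (Y : ModuleCat A) (a : A)
    (ha : ∀ n : N, a • n = 0) (hY : IsIso (a • 𝟙 Y)) (i : ℕ) :
    ¬ Nontrivial (((Tor (ModuleCat A) i).obj (ModuleCat.of A N)).obj Y) := by
  rw [not_nontrivial_iff_subsingleton, ← ModuleCat.isZero_iff_subsingleton]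
  let F := (MonoidalCategory.tensoringLeft (ModuleCat A)).obj (ModuleCat.of A N)
  let P := projectiveResolution Y
  change Limits.IsZero ((F.leftDerived i).obj Y)
  have h := P.isoLeftDerivedObj_hom_naturality (a • 𝟙 Y) P (a • 𝟙 _) (by
    simp only [HomologicalComplex.smul_f_apply, HomologicalComplex.id_f]
    refine (Linear.smul_comp _ _ _ _ _ _).trans (Eq.trans ?_ (Linear.comp_smul _ _ _ _ _ _).symm)
    congr 1) F i
  have h0 : (F.mapHomologicalComplex (ComplexShape.down ℕ)).map (a • 𝟙 P.complex) = 0 := by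
    ext j : 1
    change F.map (a • 𝟙 _) = 0
    apply ModuleCat.hom_ext
    apply TensorProduct.ext'
    intro n x
    change n ⊗ₜ[A] (a • x) = 0
    rw [tmul_smul, smul_tmul', ha, zero_tmul]
  rw [Functor.comp_map, h0, Functor.map_zero, Limits.comp_zero] at h
  have h1 : (F.leftDerived i).map (a • 𝟙 Y) = 0 := by
    rwa [← cancel_mono (P.isoLeftDerivedObj F i).hom, Limits.zero_comp]
  rw [Limits.IsZero.iff_id_eq_zero, ← cancel_mono ((F.leftDerived i).map (a • 𝟙 Y)), h1]
  simp

lemma tor_supp (N : Type) [AddCommGroup N] [Module A N] [Module.Finite A N]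
    (q : PrimeSpectrum A) :
    (∃ i : ℕ, Nontrivial (((Tor (ModuleCat A) i).obj (ModuleCat.of A N)).obj
      (ModuleCat.of A (resField q)))) ↔ q ∈ Module.support A N := by
  constructor
  · rintro ⟨i, hi⟩
    by_contra hq
    rw [Module.mem_support_iff_of_finite, SetLike.not_le_iff_exists] at hq
    obtain ⟨a, ha, haq⟩ := hq
    rw [Module.mem_annihilator] at ha
    refine tor_zero_of N _ a ha ?_ i hi
    have hu : algebraMap A (resField q) a ≠ 0 := fun h =>
      haq ((Ideal.algebraMap_residueField_eq_zero (I := q.asIdeal)).1 h)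
    rw [ConcreteCategory.isIso_iff_bijective]
    constructor
    · intro x y (hxy : a • (x : resField q) = a • (y : resField q))
      rw [Algebra.smul_def, Algebra.smul_def] at hxy
      exact mul_left_cancel₀ hu hxy
    · intro y
      refine ⟨((algebraMap A (resField q) a)⁻¹ * y : resField q), ?_⟩
      change a • ((algebraMap A (resField q) a)⁻¹ * y : resField q) = y
      rw [Algebra.smul_def, mul_inv_cancel_left₀ hu]
  · intro hq
    have h := (Module.mem_support_iff_nontrivial_residueField_tensorProduct (R := A) (M := N) q).1 hq
    refine ⟨0, ?_⟩
    let F := (MonoidalCategory.tensoringLeft (ModuleCat A)).obj (ModuleCat.of A N)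
    have : Limits.PreservesFiniteColimits F :=
      inferInstanceAs (Limits.PreservesFiniteColimits
        (MonoidalCategory.tensorLeft (ModuleCat.of A N)))
    let e := (F.leftDerivedZeroIsoSelf.app (ModuleCat.of A (resField q))).toLinearEquiv
    let e2 : N ⊗[A] resField q ≃ₗ[A] resField q ⊗[A] N := TensorProduct.comm _ _ _
    have : Nontrivial (N ⊗[A] resField q) := e2.toEquiv.nontrivial
    exact Equiv.nontrivial (β := N ⊗[A] resField q) e.toEquiv

theorem main {S : Type} [CommRing S] [Algebra S A] [IsNoetherianRing A]
    (N : Type) [AddCommGroup N] [Module A N] [Module S N]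
    (hN : ∀ (s : S) (n : N), algebraMap S A s • n = s • n)
    [Module.Finite A N]
    (E : PrimeSpectrum A → Type) [∀ q, AddCommGroup (E q)] [∀ q, Module A (E q)]
    [∀ q, Module S (E q)] (hE : ∀ q (s : S) (n : E q), algebraMap S A s • n = s • n)
    (ι : ∀ q : PrimeSpectrum A, (A ⧸ q.asIdeal) →ₗ[A] E q) (hι : ∀ q, RF q (E q) (ι q))
    (hφ : ∀ q ∈ Module.support A N, ∃ φ : N →ₗ[A] E q, φ ≠ 0)
    (Y : ModuleCat S) :
    (∃ i : ℕ, Nontrivial (((Tor (ModuleCat S) i).obj (ModuleCat.of S N)).obj Y)) ↔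
      ∃ q : PrimeSpectrum A, q ∈ Module.support A N ∧
        (∃ j : ℕ, Nontrivial
          (((Tor (ModuleCat S) j).obj (ModuleCat.of S (E q))).obj Y)) := by
  have : IsScalarTower S A N := IsScalarTower.of_algebraMap_smul hN
  have : ∀ q, IsScalarTower S A (E q) := fun q => IsScalarTower.of_algebraMap_smul (hE q)
  let P := projectiveResolution Y
  simp only [tor_iff _ _ P]
  have : ∀ i, Module.Flat S (P.complex.X i) := fun i => by
    have := (IsProjective.iff_projective (R := S) (P.complex.X i)).2 (P.projective i)
    infer_instance
  have h := core (A := A) (K := fun i => A ⊗[S] P.complex.X i)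
    (d := fun i j => (dd' P i j).baseChange A) (fun i => by
      have : dd' P i (i-1) ∘ₗ dd' P (i+1) i = 0 :=
        congrArg ModuleCat.Hom.hom (P.complex.d_comp_d (i+1) i (i-1))
      rw [← LinearMap.baseChange_comp, this, LinearMap.baseChange_zero])
    (by
      have : dd' P 0 0 = 0 := congrArg ModuleCat.Hom.hom (P.complex.shape 0 0 (by simp))
      rw [this, LinearMap.baseChange_zero])
    E ι hι N hφ
  simp only [← vv_baseChange (dd' P)] at h
  rw [← not_iff_not]
  push Not
  exact h
end
end Core

/-- for a noetherian `k`-algebra `S`, `S^e = S ⊗ₖ S`, a finitely generated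
`S^e`-module `N` regarded as an `S`-module via `Δ`, and a prime `p` of `S`:
`p ∈ supp_S N` iff `supp_{S^e}(N) ∩ supp_{S^e}(S^e ⊗_S^L κ(p)) ≠ ∅`.  Here
`q ∈ supp_{S^e}(S^e ⊗_S^L κ(p))` is expressed, via the base-change isomorphism
`κ(q) ⊗_{S^e}^L (S^e ⊗_S^L κ(p)) ≃ κ(q) ⊗_S^L κ(p)`, as `Tor^S(κ(q), κ(p)) ≠ 0`,
with `κ(q)` an `S`-module via `Δ`. -/
theorem stmt6 (k : Type) [Field k] (S : Type) [CommRing S] [Algebra k S]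
    [IsNoetherianRing S] [IsNoetherianRing (S ⊗[k] S)]
    (Δ : S →ₐ[k] (S ⊗[k] S))
    (N : Type) [AddCommGroup N] [Module (S ⊗[k] S) N] [Module.Finite (S ⊗[k] S) N]
    (p : PrimeSpectrum S) :
    (∃ i : ℕ, Nontrivial
        (((Tor (ModuleCat S) i).obj (restrictDelta Δ N)).obj (ModuleCat.of S (resField p)))) ↔
      ∃ q : PrimeSpectrum (S ⊗[k] S),
        (∃ i : ℕ, Nontrivial
          (((Tor (ModuleCat (S ⊗[k] S)) i).obj (ModuleCat.of (S ⊗[k] S) N)).obj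
            (ModuleCat.of (S ⊗[k] S) (resField q)))) ∧
        (∃ j : ℕ, Nontrivial
          (((Tor (ModuleCat S) j).obj (restrictDelta Δ (resField q))).obj
            (ModuleCat.of S (resField p)))) := by
  simp only [Core.tor_supp]
  choose ι hι using Core.rf (A := S ⊗[k] S)
  exact @Core.main (S ⊗[k] S) _ S _ Δ.toRingHom.toAlgebra _ N _ _
    (Module.compHom N Δ.toRingHom) (fun _ _ => rfl) _ (fun q => resField q) _ _
    (fun q => Module.compHom (resField q) Δ.toRingHom) (fun _ _ _ => rfl) ι hι
    (Core.exists_functional N) (ModuleCat.of S (resField p))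
end

section
/- Let k be a field, S = k[χ₁,…,χ_c], and let X, Y be bounded-below complexes of free S-modules with finitely generated homology. Then H(X ⊗_S Y) computed via the Künneth spectral sequence satisfies: Supp_S H(X ⊗_S Y) = Supp_S H(X) ∩ Supp_S H(Y). -/
open TensorProduct CategoryTheory Limits MonoidalCategory

variable {R : Type} [CommRing R]

noncomputable instance (Z : ModuleCat R) :
    PreservesColimitsOfSize.{0, 0} ((curriedTensor (ModuleCat R)).obj Z) :=
  (ihom.adjunction Z).leftAdjoint_preservesColimits

noncomputable instance (Z : ModuleCat R) :
    PreservesColimitsOfSize.{0, 0} ((curriedTensor (ModuleCat R)).flip.obj Z) :=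
  preservesColimits_of_natIso
    (F := (curriedTensor (ModuleCat R)).obj Z)
    (NatIso.ofComponents (fun Y => β_ Z Y) (by intros; simp))

instance : (curriedTensor (ModuleCat R)).Additive where
  map_add := by intros; ext Y : 2; simp [curriedTensor, MonoidalPreadditive.add_whiskerRight]

instance (X : ModuleCat R) : ((curriedTensor (ModuleCat R)).obj X).Additive where
  map_add := by intros; simp [curriedTensor, MonoidalPreadditive.whiskerLeft_add]


namespace Stmt9Aux

open HomologicalComplex

abbrev Cx (R : Type) [CommRing R] := HomologicalComplex (ModuleCat.{0} R) (ComplexShape.up ℤ)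

lemma exists_kill {M : ModuleCat.{0} R} [Module.Finite R M] {p : PrimeSpectrum R}
    (h : p ∉ Module.support R M) : ∃ u ∉ p.asIdeal, u • 𝟙 M = 0 := by
  rw [Module.mem_support_iff_of_finite, SetLike.not_le_iff_exists] at h
  obtain ⟨u, hu, hup⟩ := h
  refine ⟨u, hup, ?_⟩
  ext m
  exact Module.mem_annihilator.1 hu m

lemma step (X : Cx R) (hX : ∀ n : ℤ, Module.Free R (X.X n)) (p : PrimeSpectrum R) (i : ℤ)
    [Module.Finite R (X.homology i)] (hi : p ∉ Module.support R (X.homology i))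
    (s : R) (hs : s ∉ p.asIdeal) (f : X ⟶ X) (hf : Nonempty (Homotopy f 0))
    (hfs : ∀ n > i, f.f n = s • 𝟙 _) :
    ∃ s' ∉ p.asIdeal, ∃ f' : X ⟶ X, Nonempty (Homotopy f' 0) ∧ ∀ n ≥ i, f'.f n = s' • 𝟙 _ := by
  obtain ⟨u, hu, hu0⟩ := exists_kill hi
  obtain ⟨H⟩ := hf
  have hcyc : (s • 𝟙 (X.X i) - f.f i) ≫ X.d i (i+1) = 0 := by
    rw [Preadditive.sub_comp, f.comm, hfs (i+1) (by lia)]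
    simp
  let π := X.liftCycles _ (i+1) (by simp) hcyc
  have hπ0 : (u • π) ≫ X.homologyπ i = 0 := by
    have : (u • π) ≫ X.homologyπ i = π ≫ X.homologyπ i ≫ (u • 𝟙 _) := by simp
    rw [this, hu0]; simp
  have hproj : Projective (X.X i) := by
    have := hX i
    infer_instance
  have hex : (ShortComplex.mk (X.toCycles (i-1) i) (X.homologyπ i) (by simp)).Exact :=
    ShortComplex.exact_of_g_is_cokernel _ (X.homologyIsCokernel (i-1) i (by simp))
  let g := hex.liftFromProjective (u • π) hπ0
  have hg : g ≫ X.d (i-1) i = u • (s • 𝟙 (X.X i) - f.f i) := by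
    rw [← X.toCycles_i]
    have : g ≫ X.toCycles (i-1) i = u • π := hex.liftFromProjective_comp _ _
    rw [reassoc_of% this]
    simp [π]
  let h : ∀ a b : ℤ, X.X a ⟶ X.X b := fun a b =>
    if hab : a = i ∧ b = i - 1 then (X.XIsoOfEq hab.1).hom ≫ g ≫ (X.XIsoOfEq hab.2).inv else 0
  refine ⟨u * s, fun hh => (p.isPrime.mem_or_mem hh).elim hu hs,
    u • f + Homotopy.nullHomotopicMap h, ⟨?_⟩, ?_⟩
  · refine ((H.smul u).add (Homotopy.nullHomotopy h ?_)).trans (Homotopy.ofEq (by simp))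
    intro a b hab
    simp only [h]
    rw [dif_neg]
    rintro ⟨rfl, rfl⟩
    simp at hab
  · intro n hn
    have key : (Homotopy.nullHomotopicMap h).f n = X.d n (n+1) ≫ h (n+1) n + h n (n-1) ≫ X.d (n-1) n :=
      Homotopy.nullHomotopicMap_f (by simp) (by simp) h
    have h1 : h (n+1) n = 0 := dif_neg (by lia)
    rw [add_f_apply, key, h1, comp_zero, zero_add, smul_f_apply]
    rcases hn.lt_or_eq with hn | rfl
    · have h2 : h n (n-1) = 0 := dif_neg (by lia)
      rw [h2, hfs n hn, zero_comp, add_zero, mul_smul]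
    · have h2 : h i (i-1) = g := by simp [h]
      rw [h2, hg, smul_sub, mul_smul]
      abel

lemma exists_nullhomotopic (X : Cx R) (hX : ∀ n : ℤ, Module.Free R (X.X n)) (p : PrimeSpectrum R)
    (hb : ∃ b : ℤ, ∀ n ≥ b, Subsingleton (X.X n)) (hfg : ∀ n : ℤ, Module.Finite R (X.homology n))
    (i : ℤ) (hi : ∀ n ≥ i, p ∉ Module.support R (X.homology n)) :
    ∃ s ∉ p.asIdeal, ∃ f : X ⟶ X, Nonempty (Homotopy f 0) ∧ ∀ n ≥ i, f.f n = s • 𝟙 _ := by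
  obtain ⟨b, hb⟩ := hb
  have main : ∀ k : ℕ, ∀ i : ℤ, b - i ≤ k → (∀ n ≥ i, p ∉ Module.support R (X.homology n)) →
      ∃ s ∉ p.asIdeal, ∃ f : X ⟶ X, Nonempty (Homotopy f 0) ∧ ∀ n ≥ i, f.f n = s • 𝟙 _ := by
    intro k
    induction k with
    | zero =>
      intro i hib _
      refine ⟨1, fun h => p.isPrime.ne_top ((Ideal.eq_top_iff_one _).2 h), 0,
        ⟨Homotopy.refl _⟩, fun n hn => ?_⟩
      have := hb n (by simp at hib; lia)
      ext x
      exact Subsingleton.elim _ _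
    | succ k ih =>
      intro i hib hi
      obtain ⟨s, hs, f, hf, hfs⟩ := ih (i+1) (by push_cast at hib; lia) (fun n hn => hi n (by lia))
      exact step X hX p i (hi i le_rfl) s hs f hf (fun n hn => hfs n (by lia))
  exact main (b - i).toNat i (by lia) hi

lemma exists_dual_ne (K V : Type) [Field K] [AddCommGroup V] [Module K V] [Nontrivial V] :
    ∃ l : V →ₗ[K] K, l ≠ 0 := by
  obtain ⟨x, hx⟩ := exists_ne (0 : V)
  by_contra! hc
  exact hx ((Module.forall_dual_apply_eq_zero_iff K x).1 (fun l => by simp [hc l]))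

lemma exists_functional {M : ModuleCat.{0} R} [Module.Finite R M] {p : PrimeSpectrum R}
    (h : p ∈ Module.support R M) :
    ∃ (l : M ⟶ ModuleCat.of R p.asIdeal.ResidueField), ∃ m : M, l m ≠ 0 := by
  rw [Module.mem_support_iff_nontrivial_residueField_tensorProduct] at h
  obtain ⟨l, hl⟩ := exists_dual_ne p.asIdeal.ResidueField (p.asIdeal.ResidueField ⊗[R] M)
  refine ⟨ModuleCat.ofHom ((l.restrictScalars R) ∘ₗ TensorProduct.mk R _ _ 1), ?_⟩
  by_contra! hc
  apply hl
  ext m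
  simpa using hc m

lemma smul_residue_ne {p : PrimeSpectrum R} {s : R} (hs : s ∉ p.asIdeal)
    {x : p.asIdeal.ResidueField} (hx : x ≠ 0) : s • x ≠ 0 := by
  rw [Algebra.smul_def]
  refine mul_ne_zero ?_ hx
  rwa [Ne, Ideal.algebraMap_residueField_eq_zero]

lemma mem_support_of (K : Cx R) (p : PrimeSpectrum R) (n : ℤ) (A : ModuleCat.{0} R)
    (t : A ⟶ K.X n) (ht : t ≫ K.d n (n+1) = 0)
    (Φ : K.X n ⟶ ModuleCat.of R p.asIdeal.ResidueField) (hΦ : K.d (n-1) n ≫ Φ = 0)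
    (h : t ≫ Φ ≠ 0) : p ∈ Module.support R (K.homology n) := by
  obtain ⟨a, ha⟩ : ∃ a, (t ≫ Φ) a ≠ 0 := by
    by_contra! hc
    apply h
    ext a
    simpa using hc a
  let L : K.homology n ⟶ _ := K.homologyι n ≫ K.descOpcycles Φ (n-1) (by simp) hΦ
  let c : A ⟶ K.homology n := K.liftCycles t (n+1) (by simp) ht ≫ K.homologyπ n
  have hc : c ≫ L = t ≫ Φ := by simp [c, L]
  rw [Module.mem_support_iff']
  refine ⟨c a, fun r hr h0 => ?_⟩
  apply smul_residue_ne hr ha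
  rw [← hc]
  have := congrArg L h0
  rw [map_smul, map_zero] at this
  simpa using this

/-- functional -/
lemma exists_cocycle (X : Cx R) (hX : ∀ n : ℤ, Module.Free R (X.X n)) (p : PrimeSpectrum R)
    (hb : ∃ b : ℤ, ∀ n ≥ b, Subsingleton (X.X n)) (hfg : ∀ n : ℤ, Module.Finite R (X.homology n))
    (hp : p ∈ ⋃ n : ℤ, Module.support R (X.homology n)) :
    ∃ (i : ℤ) (φ : X.X i ⟶ ModuleCat.of R p.asIdeal.ResidueField),
      X.d (i-1) i ≫ φ = 0 ∧ ∃ z : X.cycles i, (X.iCycles i ≫ φ) z ≠ 0 := by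
  obtain ⟨i, hi, hmax⟩ : ∃ i : ℤ, p ∈ Module.support R (X.homology i) ∧
      ∀ n : ℤ, p ∈ Module.support R (X.homology n) → n ≤ i := by
    obtain ⟨b, hb⟩ := hb
    apply Int.exists_greatest_of_bdd (P := fun n => p ∈ Module.support R (X.homology n))
    · refine ⟨b, fun n hn => ?_⟩
      by_contra! hlt
      have hsub := hb n hlt.le
      have hz : IsZero (X.X n) := ModuleCat.isZero_of_subsingleton _
      have hz' : IsZero (X.homology n) := by
        apply IsZero.of_epi (X.homologyπ n)
        exact IsZero.of_mono (X.iCycles n) hz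
      have := ModuleCat.subsingleton_of_isZero hz'
      rw [Module.mem_support_iff'] at hn
      obtain ⟨m, hm⟩ := hn
      exact hm 1 (fun h => p.isPrime.ne_top ((Ideal.eq_top_iff_one _).2 h))
        (Subsingleton.elim _ _)
    · simpa using hp
  obtain ⟨s, hs, f, ⟨H⟩, hfs⟩ := exists_nullhomotopic X hX p hb hfg (i+1)
    (fun n hn h => by have := hmax n h; lia)
  obtain ⟨l, m, hm⟩ := exists_functional hi
  have hcyc : (s • 𝟙 (X.X i) - f.f i) ≫ X.d i (i+1) = 0 := by
    rw [Preadditive.sub_comp, f.comm, hfs (i+1) (by lia)]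
    simp
  let π := X.liftCycles _ (i+1) (by simp) hcyc
  have hπ : X.iCycles i ≫ π ≫ X.homologyπ i = s • X.homologyπ i := by
    have h1 : X.iCycles i ≫ π = s • 𝟙 _ - cyclesMap f i := by
      rw [← cancel_mono (X.iCycles i)]
      simp [π]
    rw [reassoc_of% h1, Preadditive.sub_comp, ← homologyπ_naturality, H.homologyMap_eq]
    simp
  refine ⟨i, π ≫ X.homologyπ i ≫ l, ?_, ?_⟩
  · rw [← X.toCycles_i, Category.assoc, reassoc_of% hπ]
    simp
  · obtain ⟨z, hz⟩ := (ModuleCat.epi_iff_surjective (X.homologyπ i)).1 inferInstance m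
    refine ⟨z, ?_⟩
    rw [reassoc_of% hπ]
    have := smul_residue_ne hs hm
    rw [← hz] at this
    simpa using this

lemma kill_homology (T : Cx R) (p : PrimeSpectrum R) (s : R) (hs : s ∉ p.asIdeal) (F : T ⟶ T)
    (H : Homotopy F 0) (n : ℤ) (hF : F.f n = s • 𝟙 _) :
    p ∉ Module.support R (T.homology n) := by
  have h1 : homologyMap F n = 0 := by rw [H.homologyMap_eq, homologyMap_zero]
  have h2 : cyclesMap F n = s • 𝟙 _ := by
    rw [← cancel_mono (T.iCycles n)]
    simp [hF]
  have h3 : s • T.homologyπ n = 0 := by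
    have := homologyπ_naturality F n
    rw [h1, h2] at this
    simpa using this.symm
  rw [Module.notMem_support_iff']
  intro m
  refine ⟨s, hs, ?_⟩
  obtain ⟨z, rfl⟩ := (ModuleCat.epi_iff_surjective (T.homologyπ n)).1 inferInstance m
  exact congrArg (fun φ => φ z) h3

lemma subsingleton_tensor_left (M N : ModuleCat.{0} R) [Subsingleton M] :
    IsZero (M ⊗ N : ModuleCat.{0} R) := by
  have : Subsingleton (TensorProduct R M N) := inferInstance
  exact ModuleCat.isZero_of_subsingleton _

lemma subsingleton_tensor_right (M N : ModuleCat.{0} R) [Subsingleton N] :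
    IsZero (M ⊗ N : ModuleCat.{0} R) := by
  have : Subsingleton (TensorProduct R M N) := inferInstance
  exact ModuleCat.isZero_of_subsingleton _

lemma subset_left (X Y : Cx R) (p : PrimeSpectrum R)
    (hXfree : ∀ n : ℤ, Module.Free R (X.X n))
    (hXbdd : ∃ b : ℤ, ∀ n ≥ b, Subsingleton (X.X n))
    (hYbdd : ∃ b : ℤ, ∀ n ≥ b, Subsingleton (Y.X n))
    (hXfg : ∀ n : ℤ, Module.Finite R (X.homology n))
    (hp : ∀ n, p ∉ Module.support R (X.homology n)) (n : ℤ) :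
    p ∉ Module.support R ((HomologicalComplex.tensorObj X Y).homology n) := by
  obtain ⟨b, hb⟩ := hYbdd
  obtain ⟨s, hs, f, ⟨H⟩, hfs⟩ := exists_nullhomotopic X hXfree p hXbdd hXfg (n - b)
    (fun n _ => hp n)
  refine kill_homology _ p s hs (HomologicalComplex.tensorHom f (𝟙 Y))
    ((mapBifunctorMapHomotopy₁ H (𝟙 Y) (curriedTensor (ModuleCat R)) (ComplexShape.up ℤ)).trans
      (Homotopy.ofEq ?_)) n ?_
  · ext j : 1
    apply mapBifunctor.hom_ext
    intro i₁ i₂ h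
    rw [ι_mapBifunctorMap]
    simp
  · apply mapBifunctor.hom_ext
    intro i₁ i₂ h
    rw [ι_mapBifunctorMap]
    by_cases hi : b ≤ i₂
    · have := hb i₂ hi
      exact (subsingleton_tensor_right (X.X i₁) (Y.X i₂)).eq_of_src _ _
    · have h' : i₁ + i₂ = n := h
      rw [hfs i₁ (by lia)]
      simp

lemma subset_right (X Y : Cx R) (p : PrimeSpectrum R)
    (hYfree : ∀ n : ℤ, Module.Free R (Y.X n))
    (hXbdd : ∃ b : ℤ, ∀ n ≥ b, Subsingleton (X.X n))
    (hYbdd : ∃ b : ℤ, ∀ n ≥ b, Subsingleton (Y.X n))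
    (hYfg : ∀ n : ℤ, Module.Finite R (Y.homology n))
    (hp : ∀ n, p ∉ Module.support R (Y.homology n)) (n : ℤ) :
    p ∉ Module.support R ((HomologicalComplex.tensorObj X Y).homology n) := by
  obtain ⟨b, hb⟩ := hXbdd
  obtain ⟨s, hs, f, ⟨H⟩, hfs⟩ := exists_nullhomotopic Y hYfree p hYbdd hYfg (n - b)
    (fun n _ => hp n)
  refine kill_homology _ p s hs (HomologicalComplex.tensorHom (𝟙 X) f)
    ((mapBifunctorMapHomotopy₂ (𝟙 X) H (curriedTensor (ModuleCat R)) (ComplexShape.up ℤ)).trans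
      (Homotopy.ofEq ?_)) n ?_
  · ext j : 1
    apply mapBifunctor.hom_ext
    intro i₁ i₂ h
    rw [ι_mapBifunctorMap]
    simp
  · apply mapBifunctor.hom_ext
    intro i₁ i₂ h
    rw [ι_mapBifunctorMap]
    by_cases hi : b ≤ i₁
    · have := hb i₁ hi
      exact (subsingleton_tensor_left (X.X i₁) (Y.X i₂)).eq_of_src _ _
    · have h' : i₁ + i₂ = n := h
      rw [hfs i₂ (by lia)]
      simp

lemma superset (X Y : Cx R) (p : PrimeSpectrum R)
    (hXfree : ∀ n : ℤ, Module.Free R (X.X n)) (hYfree : ∀ n : ℤ, Module.Free R (Y.X n))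
    (hXbdd : ∃ b : ℤ, ∀ n ≥ b, Subsingleton (X.X n))
    (hYbdd : ∃ b : ℤ, ∀ n ≥ b, Subsingleton (Y.X n))
    (hXfg : ∀ n : ℤ, Module.Finite R (X.homology n))
    (hYfg : ∀ n : ℤ, Module.Finite R (Y.homology n))
    (hpX : p ∈ ⋃ n : ℤ, Module.support R (X.homology n))
    (hpY : p ∈ ⋃ n : ℤ, Module.support R (Y.homology n)) :
    p ∈ ⋃ n : ℤ, Module.support R ((HomologicalComplex.tensorObj X Y).homology n) := by
  obtain ⟨i, φ, hφ, z, hz⟩ := exists_cocycle X hXfree p hXbdd hXfg hpX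
  obtain ⟨j, ψ, hψ, w, hw⟩ := exists_cocycle Y hYfree p hYbdd hYfg hpY
  refine Set.mem_iUnion.2 ⟨i + j, ?_⟩
  let μ : (ModuleCat.of R p.asIdeal.ResidueField ⊗ ModuleCat.of R p.asIdeal.ResidueField :
      ModuleCat R) ⟶ ModuleCat.of R p.asIdeal.ResidueField :=
    ModuleCat.ofHom (LinearMap.mul' R p.asIdeal.ResidueField)
  let Φ' : ∀ (a b : ℤ), (X.X a ⊗ Y.X b : ModuleCat R) ⟶ ModuleCat.of R p.asIdeal.ResidueField :=
    fun a b => if hab : a = i ∧ b = j then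
      (((X.XIsoOfEq hab.1).hom ≫ φ) ⊗ₘ ((Y.XIsoOfEq hab.2).hom ≫ ψ)) ≫ μ else 0
  have hΦ1 : Φ' i j = (φ ⊗ₘ ψ) ≫ μ := by simp [Φ']
  have hΦ2 : ∀ a b, a + 1 + b = i + j → X.d a (a+1) ▷ Y.X b ≫ Φ' (a+1) b = 0 := by
    intro a b hab
    by_cases h : a + 1 = i
    · obtain rfl : b = j := by lia
      obtain rfl : a = i - 1 := by lia
      have : ∀ i', i' = i → X.d (i-1) i' ▷ Y.X b ≫ Φ' i' b = 0 := by
        rintro _ rfl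
        rw [hΦ1, MonoidalCategory.tensorHom_def, Category.assoc, ← comp_whiskerRight_assoc, hφ]
        simp
      exact this _ h
    · have : Φ' (a+1) b = 0 := dif_neg (by tauto)
      rw [this, comp_zero]
  have hΦ3 : ∀ a b, a + (b + 1) = i + j → X.X a ◁ Y.d b (b+1) ≫ Φ' a (b+1) = 0 := by
    intro a b hab
    by_cases h : b + 1 = j
    · obtain rfl : a = i := by lia
      obtain rfl : b = j - 1 := by lia
      have : ∀ j', j' = j → X.X a ◁ Y.d (j-1) j' ≫ Φ' a j' = 0 := by
        rintro _ rfl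
        rw [hΦ1, MonoidalCategory.tensorHom_def', Category.assoc, ← whiskerLeft_comp_assoc, hψ]
        simp
      exact this _ h
    · have : Φ' a (b+1) = 0 := dif_neg (by tauto)
      rw [this, comp_zero]
  refine mem_support_of _ p (i + j) (X.cycles i ⊗ Y.cycles j)
    ((X.iCycles i ⊗ₘ Y.iCycles j) ≫ ιTensorObj X Y i j (i+j) rfl) ?_
    (mapBifunctorDesc (fun a b _ => Φ' a b)) ?_ ?_
  · rw [Category.assoc, mapBifunctor.d_eq, Preadditive.comp_add, mapBifunctor.ι_D₁,
      mapBifunctor.ι_D₂,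
      mapBifunctor.d₁_eq _ _ _ _ (i₁' := i + 1) (by simp) _ _ (show i + 1 + j = i + j + 1 by lia),
      mapBifunctor.d₂_eq _ _ _ _ _ (i₂' := j + 1) (by simp) _ (show i + (j + 1) = i + j + 1 by lia)]
    have e1 : (X.iCycles i ⊗ₘ Y.iCycles j) ≫
        ((curriedTensor (ModuleCat R)).map (X.d i (i+1))).app (Y.X j) = 0 := by
      simp [MonoidalCategory.tensorHom_def', ← comp_whiskerRight]
    have e2 : (X.iCycles i ⊗ₘ Y.iCycles j) ≫
        ((curriedTensor (ModuleCat R)).obj (X.X i)).map (Y.d j (j+1)) = 0 := by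
      simp [MonoidalCategory.tensorHom_def, ← whiskerLeft_comp]
    rw [Preadditive.comp_add, Linear.comp_units_smul, Linear.comp_units_smul,
      reassoc_of% e1, reassoc_of% e2]
    simp
  · apply mapBifunctor.hom_ext
    intro a b h
    have h' : a + b = i + j - 1 := h
    rw [comp_zero, mapBifunctor.d_eq, Preadditive.add_comp, Preadditive.comp_add,
      mapBifunctor.ι_D₁_assoc, mapBifunctor.ι_D₂_assoc,
      mapBifunctor.d₁_eq _ _ _ _ (i₁' := a + 1) (by simp) _ _ (show a + 1 + b = i + j by lia),
      mapBifunctor.d₂_eq _ _ _ _ _ (i₂' := b + 1) (by simp) _ (show a + (b + 1) = i + j by lia),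
      Linear.units_smul_comp, Linear.units_smul_comp, Category.assoc, Category.assoc,
      ι_mapBifunctorDesc, ι_mapBifunctorDesc]
    have e1 := hΦ2 a b (by lia)
    have e2 := hΦ3 a b (by lia)
    dsimp
    rw [e1, e2]
    simp
  · rw [Category.assoc, ι_mapBifunctorDesc, hΦ1]
    intro h0
    have := congrArg (fun q => q (z ⊗ₜ[R] w)) h0
    exact mul_ne_zero hz hw this

end Stmt9Aux

set_option synthInstance.maxHeartbeats 1600000 in
set_option maxHeartbeats 3200000 in
/-- for `S = k[χ₁,…,χ_c]` and bounded (below) complexes `X, Y` of free `S`-modules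
with finitely generated homology, the homology of the tensor product complex `X ⊗_S Y` (which
computes the derived tensor product, as the terms are free) satisfies
`Supp_S H(X ⊗_S Y) = Supp_S H(X) ∩ Supp_S H(Y)`. -/
theorem stmt9 (k : Type) [Field k] (c : ℕ) (hR : R = MvPolynomial (Fin c) k)
    (X Y : HomologicalComplex (ModuleCat R) (ComplexShape.up ℤ))
    (hXfree : ∀ n : ℤ, Module.Free R (X.X n)) (hYfree : ∀ n : ℤ, Module.Free R (Y.X n))
    (hXbdd : ∃ b : ℤ, ∀ n ≥ b, Subsingleton (X.X n))
    (hYbdd : ∃ b : ℤ, ∀ n ≥ b, Subsingleton (Y.X n))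
    (hXfg : ∀ n : ℤ, Module.Finite R (X.homology n))
    (hYfg : ∀ n : ℤ, Module.Finite R (Y.homology n)) :
    (⋃ n : ℤ, Module.support R
        (((X ⊗ Y : HomologicalComplex (ModuleCat R) (ComplexShape.up ℤ))).homology n)) =
      (⋃ n : ℤ, Module.support R (X.homology n)) ∩
        (⋃ n : ℤ, Module.support R (Y.homology n)) := by
  ext p
  constructor
  · intro hp
    obtain ⟨n, hn⟩ := Set.mem_iUnion.1 hp
    constructor
    · by_contra hc
      exact Stmt9Aux.subset_left X Y p hXfree hXbdd hYbdd hXfg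
        (fun m hm => hc (Set.mem_iUnion.2 ⟨m, hm⟩)) n hn
    · by_contra hc
      exact Stmt9Aux.subset_right X Y p hYfree hXbdd hYbdd hYfg
        (fun m hm => hc (Set.mem_iUnion.2 ⟨m, hm⟩)) n hn
  · rintro ⟨h1, h2⟩
    exact Stmt9Aux.superset X Y p hXfree hYfree hXbdd hYbdd hXfg hYfg h1 h2
end
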